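/- (Achievable target kernels.) Fix N ≥ 1 and set m = N − ⌊N/2⌋. There exist real polynomials P_{i,j} in two variables, for 1 ≤ i ≤ j ≤ m, depending only on N, with the following property: for every (C_1, …, C_m) ∈ ℝ^m, the map M : ℤ → ℝ defined by M(⌊N/2⌋ + i) = C_i for 1 ≤ i ≤ m, M(−d) = −M(d), and M(d) = 0 for all other d, satisfies conditions (M1) and (M2), and its kernel satisfies K̂_M(k,k') = 16 sin²(πk) sin²(πk') · ∑_{1≤i≤j≤m} C_i C_j P_{i,j}(cos(πk), cos(πk')) for all k, k' ∈ ℝ. -/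

import Mathlib

open Finset Real

noncomputable def Sig (N : ℕ) (M : ℤ → ℝ) (d : ℤ) : ℝ :=
  ∑ d₁ ∈ Finset.Icc (-(N:ℤ)) N, ∑ d₂ ∈ Finset.Icc (-(N:ℤ)) N,
    if d₁ + d₂ = d ∧ d₁ ≠ 0 ∧ d₂ ≠ 0 then M d₁ * M d₂ else 0

/-- The kernel coefficients `K_M(d,d')`. -/
noncomputable def Kcoef (N : ℕ) (M : ℤ → ℝ) (d d' : ℤ) : ℝ :=
  if d = 0 ∧ d' = 0 then 3 * ∑ j ∈ Finset.Icc (1:ℤ) N, M j ^ 2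
  else if 1 ≤ |d| ∧ |d| ≤ (N:ℤ) ∧ d' = 0 then -(M d ^ 2) - (1/2) * Sig N M d
  else if 1 ≤ |d'| ∧ |d'| ≤ (N:ℤ) ∧ d = 0 then -(M d' ^ 2) - (1/2) * Sig N M d'
  else if (N:ℤ) + 1 ≤ |d| ∧ |d| ≤ 2*(N:ℤ) ∧ d' = 0 then -(1/2) * Sig N M d
  else if (N:ℤ) + 1 ≤ |d'| ∧ |d'| ≤ 2*(N:ℤ) ∧ d = 0 then -(1/2) * Sig N M d'
  else if (d' = d ∨ d' = -d) ∧ 1 ≤ |d| ∧ |d| ≤ 2*(N:ℤ) then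
    if 2*|d| ≤ (N:ℤ) then -(1/4) * Sig N M d - M d * M (2*d)
    else -(1/4) * Sig N M d
  else if 1 ≤ |d| ∧ |d| ≤ (N:ℤ) ∧ (N:ℤ) < |d'| ∧ |d'| ≤ 2*(N:ℤ) then
    if |d' - d| ≤ (N:ℤ) then (1/2) * (M d * M (d' - d))
    else if |d' + d| ≤ (N:ℤ) then -(1/2) * (M d * M (d' + d))
    else 0
  else if 1 ≤ |d'| ∧ |d'| ≤ (N:ℤ) ∧ (N:ℤ) < |d| ∧ |d| ≤ 2*(N:ℤ) then
    if |d - d'| ≤ (N:ℤ) then (1/2) * (M d' * M (d - d'))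
    else if |d + d'| ≤ (N:ℤ) then -(1/2) * (M d' * M (d + d'))
    else 0
  else if 1 ≤ |d| ∧ |d| ≤ (N:ℤ) ∧ 1 ≤ |d'| ∧ |d'| ≤ (N:ℤ) then
    if |d - d'| ≤ (N:ℤ) ∧ |d + d'| ≤ (N:ℤ) then
      (1/2) * (M d' * M (d - d') + M d * M (d' - d)
        - M d' * M (d + d') - M d * M (d + d'))
    else if |d - d'| ≤ (N:ℤ) ∧ (N:ℤ) < |d + d'| then
      (1/2) * (M d' * M (d - d') + M d * M (d' - d))
    else if |d + d'| ≤ (N:ℤ) ∧ (N:ℤ) < |d - d'| then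
      -(1/2) * (M d' * M (d + d') + M d * M (d + d'))
    else 0
  else 0

/-- The controlled kernel `K̂_M(k,k')`. -/
noncomputable def Khat (N : ℕ) (M : ℤ → ℝ) (k k' : ℝ) : ℝ :=
  ∑ d ∈ Finset.Icc (-(2*(N:ℤ))) (2*(N:ℤ)), ∑ d' ∈ Finset.Icc (-(2*(N:ℤ))) (2*(N:ℤ)),
    Kcoef N M d d' * Real.cos (2*π*d*k) * Real.cos (2*π*d'*k')

/-- The control `M` built from free parameters `C_i`, `⌊N/2⌋ < i ≤ N`:
`M(i) = C_i` for `⌊N/2⌋ < i ≤ N`, `M(−d) = −M(d)`, and `M(d) = 0` otherwise. -/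
noncomputable def Mof (N : ℕ) (C : ℤ → ℝ) (d : ℤ) : ℝ :=
  if (N:ℤ)/2 < d ∧ d ≤ (N:ℤ) then C d
  else if (N:ℤ)/2 < -d ∧ -d ≤ (N:ℤ) then -C (-d)
  else 0


/-- Uniform formula for the kernel coefficients. -/
noncomputable def Kf (N : ℕ) (M : ℤ → ℝ) (d d' : ℤ) : ℝ :=
  (1/2) * (M d' * M (d - d') + M d * M (d' - d) - M d' * M (d + d') - M d * M (d + d'))
  + (if d' = 0 then -(1/2) * Sig N M d else 0) + (if d = 0 then -(1/2) * Sig N M d' else 0)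
  + (if d = d' then -(1/4) * Sig N M d' else 0) + (if d = -d' then -(1/4) * Sig N M d' else 0)

structure Good (N : ℕ) (M : ℤ → ℝ) : Prop where
  odd : ∀ d, M (-d) = - M d
  small : ∀ d : ℤ, 2 * |d| ≤ (N:ℤ) → M d = 0
  big : ∀ d : ℤ, (N:ℤ) < |d| → M d = 0

theorem sum_reflect (L : ℤ) (f : ℤ → ℝ) :
    ∑ d ∈ Finset.Icc (-L) L, f (-d) = ∑ d ∈ Finset.Icc (-L) L, f d := by
  refine Finset.sum_nbij' (fun d => -d) (fun d => -d) ?_ ?_ ?_ ?_ ?_ <;> intros <;> simp_all <;> omega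

theorem Good.zero {N : ℕ} {M : ℤ → ℝ} (h : Good N M) : M 0 = 0 := h.small 0 (by simp)

theorem Good.sig {N : ℕ} {M : ℤ → ℝ} (h : Good N M) (d : ℤ) :
    Sig N M d = ∑ e ∈ Finset.Icc (-(2*(N:ℤ))) (2*(N:ℤ)), M e * M (d - e) := by
  unfold Sig
  rw [← Finset.sum_subset (s₁ := Finset.Icc (-(N:ℤ)) N)
    (s₂ := Finset.Icc (-(2*(N:ℤ))) (2*(N:ℤ))) (f := fun e => M e * M (d - e))]
  · refine Finset.sum_congr rfl fun e he => ?_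
    by_cases hb : (N:ℤ) < |d - e|
    · rw [h.big _ hb, mul_zero]
      refine Finset.sum_eq_zero fun f hf => ?_
      rw [if_neg]
      rintro ⟨h1, -⟩
      simp only [Finset.mem_Icc] at hf
      have : |d - e| ≤ N := abs_le.2 (by omega)
      omega
    · rw [Finset.sum_eq_single (d - e)]
      · by_cases h0 : e = 0
        · simp [h0, h.zero]
        by_cases h1 : d - e = 0
        · simp [h1, h.zero]
        rw [if_pos ⟨by omega, h0, h1⟩]
      · intro f _ hf
        rw [if_neg]
        rintro ⟨h1, -⟩
        omega
      · intro hf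
        exfalso
        apply hf
        rw [not_lt, abs_le] at hb
        simpa using hb
  · intro x
    simp only [Finset.mem_Icc]
    omega
  · intro x _ hx
    rw [h.big x, zero_mul]
    by_contra hc
    rw [not_lt, abs_le] at hc
    exact hx (by simpa using hc)

theorem Good.sig_neg {N : ℕ} {M : ℤ → ℝ} (h : Good N M) (d : ℤ) : Sig N M (-d) = Sig N M d := by
  rw [h.sig, h.sig, ← sum_reflect]
  refine Finset.sum_congr rfl fun e _ => ?_
  rw [h.odd, show -d - -e = -(d - e) by ring, h.odd]
  ring

theorem Good.sig_zero {N : ℕ} {M : ℤ → ℝ} (h : Good N M) :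
    Sig N M 0 = - 2 * ∑ j ∈ Finset.Icc (1:ℤ) N, M j ^ 2 := by
  have e1 : Sig N M 0 = - ∑ e ∈ Finset.Icc (-(N:ℤ)) N, M e ^ 2 := by
    rw [h.sig, ← Finset.sum_neg_distrib]
    symm
    apply Finset.sum_subset_zero_on_sdiff
    · intro x
      simp only [Finset.mem_Icc]
      omega
    · intro x hx
      simp only [Finset.mem_sdiff, Finset.mem_Icc] at hx
      rw [h.big x, zero_mul]
      by_contra hc
      rw [not_lt, abs_le] at hc
      exact hx.2 (by simpa using hc)
    · intro x _
      rw [zero_sub, h.odd]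
      ring
  have e2 : Finset.Icc (-(N:ℤ)) N = (Finset.Icc (-(N:ℤ)) (-1) ∪ {0}) ∪ Finset.Icc (1:ℤ) N := by
    ext x
    simp only [Finset.mem_union, Finset.mem_Icc, Finset.mem_singleton]
    omega
  have e3 : ∑ e ∈ Finset.Icc (-(N:ℤ)) (-1), M e ^ 2 = ∑ e ∈ Finset.Icc (1:ℤ) N, M e ^ 2 := by
    refine Finset.sum_nbij' (fun d => -d) (fun d => -d) ?_ ?_ ?_ ?_ ?_
    · intro a; simp only [Finset.mem_Icc]; omega
    · intro a; simp only [Finset.mem_Icc]; omega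
    · simp
    · simp
    · intro a _; rw [h.odd]; ring
  rw [e1, e2, Finset.sum_union, Finset.sum_union, e3]
  · simp [h.zero]; ring
  · rw [Finset.disjoint_left]; intro x; simp only [Finset.mem_Icc, Finset.mem_singleton]; omega
  · rw [Finset.disjoint_left]; intro x
    simp only [Finset.mem_union, Finset.mem_Icc, Finset.mem_singleton]; omega

theorem Good.shift_sum {N : ℕ} {M : ℤ → ℝ} (h : Good N M) (d' : ℤ) (hd : |d'| ≤ N) :
    ∑ d ∈ Finset.Icc (-(2*(N:ℤ))) (2*(N:ℤ)), M (d - d') = 0 := by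
  have e0 : ∑ d ∈ Finset.Icc (-(N:ℤ)) N, M d = 0 := by
    have := sum_reflect N M
    simp only [h.odd, Finset.sum_neg_distrib] at this
    linarith
  rw [abs_le] at hd
  have e1 : ∑ d ∈ Finset.Icc (-(N:ℤ)) N, M d
      = ∑ d ∈ Finset.Icc (-(N:ℤ) + d') (N + d'), M (d - d') := by
    refine Finset.sum_nbij' (fun d => d + d') (fun d => d - d') ?_ ?_ ?_ ?_ ?_
    · intro a; simp only [Finset.mem_Icc]; omega
    · intro a; simp only [Finset.mem_Icc]; omega
    · simp
    · simp
    · simp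
  rw [← e0, e1]
  symm
  apply Finset.sum_subset
  · intro x
    simp only [Finset.mem_Icc]
    omega
  · intro x _ hx
    apply h.big
    by_contra hc
    rw [not_lt, abs_le] at hc
    apply hx
    simp only [Finset.mem_Icc]
    omega

theorem Good.sum_sig {N : ℕ} {M : ℤ → ℝ} (h : Good N M) :
    ∑ d ∈ Finset.Icc (-(2*(N:ℤ))) (2*(N:ℤ)), Sig N M d = 0 := by
  simp_rw [h.sig]
  rw [Finset.sum_comm]
  refine Finset.sum_eq_zero fun e _ => ?_
  rw [← Finset.mul_sum]
  by_cases hb : (N:ℤ) < |e|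
  · rw [h.big _ hb, zero_mul]
  · rw [h.shift_sum e (by omega), mul_zero]

theorem Good.symm {N : ℕ} {M : ℤ → ℝ} (h : Good N M) (d d' : ℤ) : Kf N M d d' = Kf N M d' d := by
  unfold Kf
  have e1 : (if d = d' then -(1/4) * Sig N M d' else 0)
    = (if d' = d then -(1/4) * Sig N M d else 0) := by
    by_cases hd : d = d'
    · simp [hd]
    · simp [hd, Ne.symm hd]
  have e2 : (if d = -d' then -(1/4) * Sig N M d' else 0)
    = (if d' = -d then -(1/4) * Sig N M d else 0) := by
    by_cases hd : d = -d'
    · simp [hd, h.sig_neg]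
    · rw [if_neg hd, if_neg (by omega)]
  rw [e1, e2, add_comm d' d]
  ring

theorem Good.row {N : ℕ} {M : ℤ → ℝ} (h : Good N M) (d' : ℤ)
    (hd : d' ∈ Finset.Icc (-(2*(N:ℤ))) (2*(N:ℤ))) :
    ∑ d ∈ Finset.Icc (-(2*(N:ℤ))) (2*(N:ℤ)), Kf N M d d' = 0 := by
  unfold Kf
  have hd2 : -d' ∈ Finset.Icc (-(2*(N:ℤ))) (2*(N:ℤ)) := by
    simp only [Finset.mem_Icc] at hd ⊢; omega
  have hd0 : (0:ℤ) ∈ Finset.Icc (-(2*(N:ℤ))) (2*(N:ℤ)) := by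
    simp only [Finset.mem_Icc]; omega
  have a1 : ∑ d ∈ Finset.Icc (-(2*(N:ℤ))) (2*(N:ℤ)), M d' * M (d - d') = 0 := by
    rw [← Finset.mul_sum]
    by_cases hb : (N:ℤ) < |d'|
    · rw [h.big _ hb, zero_mul]
    · rw [h.shift_sum d' (by omega), mul_zero]
  have a2 : ∑ d ∈ Finset.Icc (-(2*(N:ℤ))) (2*(N:ℤ)), M d' * M (d + d') = 0 := by
    rw [← Finset.mul_sum]
    by_cases hb : (N:ℤ) < |d'|
    · rw [h.big _ hb, zero_mul]
    · have := h.shift_sum (-d') (by rw [abs_neg]; omega)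
      simp only [sub_neg_eq_add] at this
      rw [this, mul_zero]
  have a3 := h.sig d'
  have a4 : ∑ d ∈ Finset.Icc (-(2*(N:ℤ))) (2*(N:ℤ)), M d * M (d + d') = - Sig N M d' := by
    rw [← h.sig_neg, h.sig, ← Finset.sum_neg_distrib]
    refine Finset.sum_congr rfl fun e _ => ?_
    rw [show -d' - e = -(e + d') by ring, h.odd]
    ring
  simp only [Finset.sum_add_distrib, ← Finset.mul_sum, Finset.sum_sub_distrib, Finset.sum_ite_eq',
    hd, hd2, hd0, if_true]
  simp only [← Finset.mul_sum] at a1 a2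
  rw [a1, a2, ← a3, a4]
  have : ∑ d ∈ Finset.Icc (-(2*(N:ℤ))) (2*(N:ℤ)), (if d' = 0 then -(1/2) * Sig N M d else 0) = 0 := by
    split_ifs
    · rw [← Finset.mul_sum, h.sum_sig, mul_zero]
    · simp
  rw [this]
  ring

theorem abs_facts (x : ℤ) : (0 ≤ x ∧ |x| = x) ∨ (x < 0 ∧ |x| = -x) := by
  rcases le_or_gt 0 x with h | h
  · exact Or.inl ⟨h, abs_of_nonneg h⟩
  · exact Or.inr ⟨h, abs_of_neg h⟩

theorem Good.MM2 {N : ℕ} {M : ℤ → ℝ} (h : Good N M) (d : ℤ) : M d * M (2 * d) = 0 := by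
  by_cases hb : 2 * |d| ≤ N
  · rw [h.small d hb, zero_mul]
  · rw [h.big (2*d), mul_zero]
    rw [abs_mul]
    simpa using hb

theorem Good.coef {N : ℕ} {M : ℤ → ℝ} (h : Good N M) (d d' : ℤ)
    (hd : |d| ≤ 2 * (N:ℤ)) (hd' : |d'| ≤ 2 * (N:ℤ)) :
    Kcoef N M d d' = Kf N M d d' := by
  by_cases h0 : d = 0
  · subst h0
    by_cases h0' : d' = 0
    · subst h0'
      simp [Kcoef, Kf, h.zero, h.sig_zero]; ring
    · have hp : 1 ≤ |d'| := Int.one_le_abs h0'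
      have : Kf N M 0 d' = -(M d' ^ 2) - (1/2) * Sig N M d' := by
        unfold Kf
        rw [if_neg h0', if_pos rfl, if_neg (by omega), if_neg (by omega)]
        simp [h.odd, h.zero]; ring
      rw [this]
      unfold Kcoef
      rw [if_neg (by omega), if_neg (by omega)]
      by_cases hb : |d'| ≤ N
      · rw [if_pos ⟨hp, hb, rfl⟩]
      · rw [if_neg (by omega), if_neg (by omega), if_pos ⟨by omega, hd', rfl⟩, h.big d' (by omega)]
        ring
  have hp : 1 ≤ |d| := Int.one_le_abs h0
  by_cases h0' : d' = 0
  · subst h0'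
    have : Kf N M d 0 = -(M d ^ 2) - (1/2) * Sig N M d := by
      unfold Kf
      rw [if_pos rfl, if_neg h0, if_neg (by omega), if_neg (by omega)]
      simp [h.odd, h.zero]; ring
    rw [this]
    unfold Kcoef
    rw [if_neg (by omega)]
    by_cases hb : |d| ≤ N
    · rw [if_pos ⟨hp, hb, rfl⟩]
    · rw [if_neg (by omega), if_neg (by omega), if_pos ⟨by omega, hd, rfl⟩, h.big d (by omega)]
      ring
  have hp' : 1 ≤ |d'| := Int.one_le_abs h0'
  unfold Kcoef
  rw [if_neg (by omega), if_neg (by omega), if_neg (by omega), if_neg (by omega), if_neg (by omega)]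
  have hMM := h.MM2 d
  by_cases h1 : d' = d
  · subst h1
    rw [if_pos ⟨Or.inl rfl, hp, hd⟩]
    have : Kf N M d' d' = -(1/4) * Sig N M d' := by
      unfold Kf
      rw [if_neg h0, if_pos rfl, if_neg (by omega), sub_self, h.zero, ← two_mul d', hMM]
      ring
    rw [this, hMM]
    simp
  by_cases h2 : d' = -d
  · subst h2
    rw [if_pos ⟨Or.inr rfl, hp, hd⟩]
    have : Kf N M d (-d) = -(1/4) * Sig N M d := by
      unfold Kf
      rw [if_neg h0', if_neg h0, if_neg (by omega), if_pos (by omega), h.sig_neg,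
        show d + -d = 0 by ring, show d - -d = 2 * d by ring, show -d - d = -(2 * d) by ring, h.zero,
        h.odd, h.odd]
      linear_combination (-1) * hMM
    rw [this, hMM]
    simp
  have key : Kf N M d d' = (1/2) * (M d' * M (d - d') + M d * M (d' - d)
      - M d' * M (d + d') - M d * M (d + d')) := by
    unfold Kf
    rw [if_neg h0', if_neg h0, if_neg (by omega), if_neg (by omega)]
    ring
  rw [key, if_neg (by omega)]
  have b1 := h.big d
  have b2 := h.big d'
  have b3 := h.big (d - d')
  have b4 := h.big (d + d')
  have o : M (d' - d) = - M (d - d') := by rw [← h.odd]; congr 1; ring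
  have c1 : |d' - d| = |d - d'| := abs_sub_comm _ _
  rw [o, c1, add_comm d' d]
  have c2 := abs_facts d
  have c3 := abs_facts d'
  have c4 := abs_facts (d - d')
  have c5 := abs_facts (d + d')
  split_ifs with i1 i2 i3 i4 i5 i6 i7 i8 i9 i10
  · rw [b2 (by omega), b4 (by omega)]; ring
  · rw [b2 (by omega), b3 (by omega)]; ring
  · rw [b2 (by omega), b3 (by omega), b4 (by omega)]; ring
  · rw [b1 (by omega), b4 (by omega)]; ring
  · rw [b1 (by omega), b3 (by omega)]; ring
  · rw [b1 (by omega), b3 (by omega), b4 (by omega)]; ring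
  · ring
  · rw [b4 (by omega)]; ring
  · rw [b3 (by omega)]; ring
  · rw [b3 (by omega), b4 (by omega)]; ring
  · rw [b1 (by omega), b2 (by omega)]; ring

theorem good_Mof (N : ℕ) (C : ℤ → ℝ) : Good N (Mof N C) := by
  refine ⟨fun d => ?_, fun d hd => ?_, fun d hd => ?_⟩
  · unfold Mof
    by_cases h1 : (N:ℤ)/2 < d ∧ d ≤ (N:ℤ)
    · rw [if_neg (by omega), if_pos (by omega), if_pos h1, neg_neg]
    · by_cases h2 : (N:ℤ)/2 < -d ∧ -d ≤ (N:ℤ)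
      · rw [if_pos h2, if_neg h1, if_pos h2, neg_neg]
      · rw [if_neg h2, if_neg (by omega), if_neg h1, if_neg h2, neg_zero]
  · have := abs_facts d
    unfold Mof
    rw [if_neg (by omega), if_neg (by omega)]
  · have := abs_facts d
    unfold Mof
    rw [if_neg (by omega), if_neg (by omega)]

/-- Quadratic forms in the free parameters. -/
def IsQuad (N : ℕ) (f : (ℤ → ℝ) → ℝ) : Prop :=
  ∃ q : ℤ → ℤ → ℝ, ∀ C, f C =
    ∑ i ∈ Finset.Icc ((N:ℤ)/2 + 1) (N:ℤ), ∑ j ∈ Finset.Icc i (N:ℤ), C i * C j * q i j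

theorem IsQuad.zero (N : ℕ) : IsQuad N (fun _ => 0) := ⟨fun _ _ => 0, by simp⟩

theorem IsQuad.add {N : ℕ} {f g} (hf : IsQuad N f) (hg : IsQuad N g) :
    IsQuad N (fun C => f C + g C) := by
  obtain ⟨p, hp⟩ := hf
  obtain ⟨q, hq⟩ := hg
  refine ⟨fun i j => p i j + q i j, fun C => ?_⟩
  simp only [hp, hq, mul_add, Finset.sum_add_distrib]

theorem IsQuad.smul {N : ℕ} {f} (r : ℝ) (hf : IsQuad N f) : IsQuad N (fun C => r * f C) := by
  obtain ⟨p, hp⟩ := hf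
  refine ⟨fun i j => r * p i j, fun C => ?_⟩
  simp only [hp, Finset.mul_sum]
  refine Finset.sum_congr rfl fun i _ => Finset.sum_congr rfl fun j _ => ?_
  ring

theorem IsQuad.sub {N : ℕ} {f g} (hf : IsQuad N f) (hg : IsQuad N g) :
    IsQuad N (fun C => f C - g C) := by
  simpa [sub_eq_add_neg] using hf.add (hg.smul (-1))

theorem IsQuad.sum {N : ℕ} {ι : Type} (s : Finset ι) (f : ι → (ℤ → ℝ) → ℝ)
    (hf : ∀ x, IsQuad N (f x)) : IsQuad N (fun C => ∑ x ∈ s, f x C) := by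
  classical
  induction s using Finset.induction_on with
  | empty => simpa using IsQuad.zero N
  | insert a s ha ih => simpa [Finset.sum_insert ha] using (hf a).add ih

theorem IsQuad.ite {N : ℕ} {f} (p : Prop) [Decidable p] (hf : IsQuad N f) :
    IsQuad N (fun C => if p then f C else 0) := by
  by_cases hp : p
  · simpa [hp] using hf
  · simpa [hp] using IsQuad.zero N

theorem IsQuad.mono_le {N : ℕ} (a b : ℤ) (ha : (N:ℤ)/2 < a) (hab : a ≤ b) (hb : b ≤ N) :
    IsQuad N (fun C => C a * C b) := by
  refine ⟨fun i j => if i = a then (if j = b then 1 else 0) else 0, fun C => ?_⟩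
  rw [Finset.sum_eq_single a, Finset.sum_eq_single b]
  · simp
  · intro j _ hj; simp [hj]
  · intro hj; exact absurd (by simp only [Finset.mem_Icc]; omega) hj
  · intro i _ hi; simp [hi]
  · intro hj; exact absurd (by simp only [Finset.mem_Icc]; omega) hj

theorem IsQuad.mono {N : ℕ} (a b : ℤ) (ha : (N:ℤ)/2 < a ∧ a ≤ N) (hb : (N:ℤ)/2 < b ∧ b ≤ N) :
    IsQuad N (fun C => C a * C b) := by
  rcases le_total a b with h | h
  · exact IsQuad.mono_le a b ha.1 h hb.2
  · simpa [mul_comm] using IsQuad.mono_le b a hb.1 h ha.2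

theorem Mof_lin (N : ℕ) (d : ℤ) :
    ∃ (r : ℝ) (a : ℤ), (r = 0 ∨ ((N:ℤ)/2 < a ∧ a ≤ N)) ∧ ∀ C, Mof N C d = r * C a := by
  unfold Mof
  split_ifs with h1 h2
  · exact ⟨1, d, Or.inr h1, by simp⟩
  · exact ⟨-1, -d, Or.inr h2, by simp⟩
  · exact ⟨0, d, Or.inl rfl, by simp⟩

theorem IsQuad.MM (N : ℕ) (a b : ℤ) : IsQuad N (fun C => Mof N C a * Mof N C b) := by
  obtain ⟨r, x, hx, h1⟩ := Mof_lin N a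
  obtain ⟨s, y, hy, h2⟩ := Mof_lin N b
  simp only [h1, h2]
  rcases hx with rfl | hx
  · simpa using IsQuad.zero N
  rcases hy with rfl | hy
  · simpa using IsQuad.zero N
  have := (IsQuad.mono x y hx hy).smul (r * s)
  refine (funext fun C => ?_ : (fun C : ℤ → ℝ => r * C x * (s * C y)) = _) ▸ this
  ring

theorem IsQuad.sig (N : ℕ) (d : ℤ) : IsQuad N (fun C => Sig N (Mof N C) d) := by
  unfold Sig
  exact IsQuad.sum _ _ fun _ => IsQuad.sum _ _ fun _ => IsQuad.ite _ (IsQuad.MM _ _ _)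

theorem IsQuad.kf (N : ℕ) (d d' : ℤ) : IsQuad N (fun C => Kf N (Mof N C) d d') := by
  unfold Kf
  exact ((((IsQuad.smul _ ((((IsQuad.MM _ _ _).add (IsQuad.MM _ _ _)).sub (IsQuad.MM _ _ _)).sub
    (IsQuad.MM _ _ _))).add (IsQuad.ite _ ((IsQuad.sig _ _).smul _))).add
    (IsQuad.ite _ ((IsQuad.sig _ _).smul _))).add (IsQuad.ite _ ((IsQuad.sig _ _).smul _))).add
    (IsQuad.ite _ ((IsQuad.sig _ _).smul _))

theorem Good.khat {N : ℕ} {M : ℤ → ℝ} (h : Good N M) (k k' : ℝ) :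
    Khat N M k k' = ∑ d ∈ Finset.Icc (-(2*(N:ℤ))) (2*(N:ℤ)),
      ∑ d' ∈ Finset.Icc (-(2*(N:ℤ))) (2*(N:ℤ)),
      Kf N M d d' * (1 - Real.cos (2*π*d*k)) * (1 - Real.cos (2*π*d'*k')) := by
  set I := Finset.Icc (-(2*(N:ℤ))) (2*(N:ℤ)) with hI
  have e0 : Khat N M k k' = ∑ d ∈ I, ∑ d' ∈ I,
      Kf N M d d' * Real.cos (2*π*d*k) * Real.cos (2*π*d'*k') := by
    unfold Khat
    refine Finset.sum_congr rfl fun d hd => Finset.sum_congr rfl fun d' hd' => ?_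
    rw [h.coef d d' (by rw [abs_le]; simpa [hI] using hd) (by rw [abs_le]; simpa [hI] using hd')]
  have e1 : ∀ f : ℤ → ℝ, ∑ d ∈ I, ∑ d' ∈ I, Kf N M d d' * f d' = 0 := by
    intro f
    rw [Finset.sum_comm]
    refine Finset.sum_eq_zero fun d' hd' => ?_
    rw [← Finset.sum_mul, h.row d' hd', zero_mul]
  have e2 : ∀ f : ℤ → ℝ, ∑ d ∈ I, ∑ d' ∈ I, Kf N M d d' * f d = 0 := by
    intro f
    refine Finset.sum_eq_zero fun d hd => ?_
    rw [← Finset.sum_mul, Finset.sum_congr rfl fun d' _ => h.symm d d', h.row d hd, zero_mul]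
  have f1 := e1 (fun d' => 1 - Real.cos (2*π*d'*k'))
  have f2 := e2 (fun d => Real.cos (2*π*d*k))
  have : ∑ d ∈ I, ∑ d' ∈ I,
      Kf N M d d' * (1 - Real.cos (2*π*d*k)) * (1 - Real.cos (2*π*d'*k'))
    = ∑ d ∈ I, ∑ d' ∈ I, Kf N M d d' * (1 - Real.cos (2*π*d'*k'))
      - ∑ d ∈ I, ∑ d' ∈ I, Kf N M d d' * Real.cos (2*π*d*k)
      + ∑ d ∈ I, ∑ d' ∈ I, Kf N M d d' * Real.cos (2*π*d*k) * Real.cos (2*π*d'*k') := by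
    simp only [← Finset.sum_sub_distrib, ← Finset.sum_add_distrib]
    refine Finset.sum_congr rfl fun d _ => Finset.sum_congr rfl fun d' _ => ?_
    ring
  rw [this, f1, f2, e0]
  ring

theorem one_sub_cos (d : ℤ) (k : ℝ) : 1 - Real.cos (2*π*d*k) =
    2 * Real.sin (π*k) ^ 2 * ((Polynomial.Chebyshev.U ℝ (d-1)).eval (Real.cos (π*k))) ^ 2 := by
  have h := Polynomial.Chebyshev.U_real_cos (π*k) (d-1)
  have e : (((d - 1 : ℤ) : ℝ) + 1) * (π * k) = π*d*k := by push_cast; ring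
  rw [e] at h
  rw [show 2*π*d*k = 2*(π*d*k) by ring, Real.cos_two_mul, Real.cos_sq', ← h]
  ring

/-- The squared Chebyshev polynomial in the variable `x`. -/
noncomputable def W (x : Fin 2) (d : ℤ) : MvPolynomial (Fin 2) ℝ :=
  (Polynomial.aeval (MvPolynomial.X x) (Polynomial.Chebyshev.U ℝ (d-1))) ^ 2

theorem eval_W (v : Fin 2 → ℝ) (x : Fin 2) (d : ℤ) : MvPolynomial.eval v (W x d) =
    ((Polynomial.Chebyshev.U ℝ (d-1)).eval (v x)) ^ 2 := by
  unfold W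
  rw [map_pow]
  congr 1
  rw [← MvPolynomial.coe_aeval_eq_eval]
  change (MvPolynomial.aeval v) _ = _
  rw [← Polynomial.aeval_algHom_apply]
  simp

/-- **Achievable target kernels (Proposition 3.6).**  Fix `N ≥ 1`.  There exist real
polynomials `P_{i,j}` in two variables, indexed by `⌊N/2⌋ < i ≤ j ≤ N` (equivalently by
`1 ≤ i ≤ j ≤ m` with `m = N − ⌊N/2⌋` after shifting by `⌊N/2⌋`), depending only on `N`,
such that for every choice of the free parameters `C`, the control `Mof N C` satisfies
conditions (M1) and (M2) and its kernel is
`K̂_M(k,k') = 16 sin²(πk) sin²(πk') ∑_{i≤j} C_i C_j P_{i,j}(cos πk, cos πk')`. -/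
theorem achievable_target_kernels (N : ℕ) (hN : 1 ≤ N) :
    ∃ P : ℤ → ℤ → MvPolynomial (Fin 2) ℝ,
      ∀ C : ℤ → ℝ,
        (∀ d : ℤ, Mof N C d + Mof N C (-d) = 0) ∧
        (∀ d : ℤ, (2*|d| ≤ (N:ℤ) ∨ (N:ℤ) < |d|) → Mof N C d = 0) ∧
        (∀ k k' : ℝ,
          Khat N (Mof N C) k k' =
            16 * Real.sin (π*k) ^ 2 * Real.sin (π*k') ^ 2 *
              ∑ i ∈ Finset.Icc ((N:ℤ)/2 + 1) (N:ℤ), ∑ j ∈ Finset.Icc i (N:ℤ),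
                C i * C j *
                  MvPolynomial.eval ![Real.cos (π*k), Real.cos (π*k')] (P i j)) := by
  choose q hq using fun d d' => IsQuad.kf N d d'
  refine ⟨fun i j => ∑ d ∈ Finset.Icc (-(2*(N:ℤ))) (2*(N:ℤ)),
      ∑ d' ∈ Finset.Icc (-(2*(N:ℤ))) (2*(N:ℤ)),
        MvPolynomial.C (q d d' i j / 4) * (W 0 d * W 1 d'), fun C => ?_⟩
  have h := good_Mof N C
  refine ⟨fun d => by rw [h.odd]; ring, fun d hd => hd.elim (h.small d) (h.big d),
    fun k k' => ?_⟩
  rw [h.khat]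
  simp only [hq, one_sub_cos, map_sum, map_mul, eval_W, MvPolynomial.eval_C, Matrix.cons_val_zero,
    Matrix.cons_val_one, Finset.mul_sum, Finset.sum_mul]
  rw [Finset.sum_congr rfl fun d _ => Finset.sum_comm, Finset.sum_comm]
  refine Finset.sum_congr rfl fun i _ => ?_
  rw [Finset.sum_congr rfl fun d _ => Finset.sum_comm, Finset.sum_comm]
  refine Finset.sum_congr rfl fun j _ => ?_
  refine Finset.sum_congr rfl fun d _ => Finset.sum_congr rfl fun d' _ => ?_
  ring
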